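/- arXiv:1006.4324 — 2 statements merged into one kernel-verified Lean document; each statement's English description precedes it below -/
import Mathlib

section
/- Fix a vertex a ≠ 0 and write a_i := p^i(a) (so a_0 = a, a_{d(a)} = 0). For 0 ≤ k ≤ d(a) set C_{a,k} := ∪_{l=k+1}^{d(a)} ∪_{c∈σ(a_l), c≠a_{l−1}} B_c. For all 0 ≤ j < n ≤ d(a), the second moment of the hitting time of a_j starting from a_n satisfies E[(T^{a_n}_{a_j})²] = Σ_{k=j}^{n−1} (2/(μ_{a_k}·π(a_k)))·( Σ_{c∈C_{a,k}} π(B_c)²/(μ_c·π(c)) + Σ_{b∈ℓ(a_k)} π(I∖B_b)²/(μ_b·π(b)) + π(I∖B_{a_k})·E[T^{a_k}_{a_j}] ) − E[T^{a_n}_{a_j}]. -/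
open MeasureTheory ProbabilityTheory Filter Topology ENNReal

noncomputable section

/-- A discrete-time birth-and-death chain on a countable rooted tree `I`.
The tree is encoded by a root, a parent map and a depth function; the chain is
encoded by its transition matrix `P` (nonzero only between tree-neighbours and
on the diagonal) and by the laws `law x` of the trajectories started at `x`,
characterised by the cylinder formula.  `invm` is the reversible invariant
probability measure of the chain (positive recurrence). -/
structure TreeChain (I : Type*) [MeasurableSpace I] where
  root : I
  par : I → I
  depth : I → ℕ
  par_root : par root = root
  depth_root : depth root = 0
  depth_eq_zero : ∀ x, depth x = 0 → x = root
  depth_par : ∀ x, x ≠ root → depth x = depth (par x) + 1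
  P : I → I → ℝ≥0∞
  P_row : ∀ x, ∑' y, P x y = 1
  P_support : ∀ x y, P x y ≠ 0 → y = x ∨ y = par x ∨ x = par y
  lam_pos : ∀ x, x ≠ root → P (par x) x ≠ 0
  mu_pos : ∀ x, x ≠ root → P x (par x) ≠ 0
  law : I → Measure (ℕ → I)
  law_prob : ∀ x, IsProbabilityMeasure (law x)
  law_start : ∀ x, law x {ω | ω 0 = x} = 1
  law_cyl : ∀ x (n : ℕ) (γ : ℕ → I), γ 0 = x →
    law x {ω | ∀ i ≤ n, ω i = γ i} = ∏ i ∈ Finset.range n, P (γ i) (γ (i + 1))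
  invm : I → ℝ≥0∞
  invm_pos : ∀ x, invm x ≠ 0
  invm_sum : ∑' x, invm x = 1
  invm_rev : ∀ x y, invm x * P x y = invm y * P y x

/-- The hitting time of `y`, as an extended nonnegative real (`∞` if `y` is never hit). -/
def hitTime {I : Type*} (y : I) (ω : ℕ → I) : ℝ≥0∞ :=
  ⨅ (t : ℕ) (_ : ω t = y), (t : ℝ≥0∞)

namespace TreeChain

variable {I : Type*} [MeasurableSpace I] (c : TreeChain I)

/-- The branch `B_x` stemming from `x`: the set of descendants of `x` (including `x`). -/
def branch (x : I) : Set I := {y | ∃ n, c.par^[n] y = x}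

/-- The set `ℓ(x)` of vertices on the path from `x` to the root, the root excluded. -/
def pathToRoot (x : I) : Set I := {y | ∃ i < c.depth x, c.par^[i] x = y}

/-- The set `σ(x)` of children of `x`. -/
def children (x : I) : Set I := {y | y ≠ c.root ∧ c.par y = x}

/-- `μ_x`, the transition probability from `x` to its parent. -/
def mu (x : I) : ℝ≥0∞ := c.P x (c.par x)

/-- `λ_x`, the transition probability from the parent of `x` to `x`. -/
def lamP (x : I) : ℝ≥0∞ := c.P (c.par x) x

/-- `π(A)`, the invariant mass of a set of vertices. -/
def piSet (A : Set I) : ℝ≥0∞ := ∑' y : A, c.invm (y : I)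

/-- `E[T^x_y]`, the expected hitting time of `y` for the chain started at `x`. -/
def ET (x y : I) : ℝ≥0∞ := ∫⁻ ω, hitTime y ω ∂(c.law x)

/-- `E[(T^x_y)²]`, the second moment of the hitting time of `y` started at `x`. -/
def ET2 (x y : I) : ℝ≥0∞ := ∫⁻ ω, (hitTime y ω) ^ 2 ∂(c.law x)

/-- The normalised hitting time `T^x_y / E[T^x_y]` as a real random variable. -/
def ratio (x y : I) (ω : ℕ → I) : ℝ := (hitTime y ω).toReal / (c.ET x y).toReal

/-- `α(a)`: the child of the root lying on the path from `a` to the root. -/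
def alphaVert (a : I) : I := c.par^[c.depth a - 1] a

/-- The drift constant `K_a = sup_{b ∈ B_{α(a)}} μ_b · E[T^b_{p(b)}]`. -/
def Kdrift (a : I) : ℝ≥0∞ :=
  ⨆ b ∈ c.branch (c.alphaVert a), c.mu b * c.ET b (c.par b)

/-- The global constant `K'_a = sup_{b ∈ I} μ_b · E[T^b_{p(b)}]`. -/
def Kdrift' : ℝ≥0∞ := ⨆ b : I, c.mu b * c.ET b (c.par b)

/-- The quantity `Q_x = π(B_x)⁻¹ · Σ_{b ∈ B_x} π(B_b)²/(μ_b π(b))`. -/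
def Qx (x : I) : ℝ≥0∞ :=
  (c.piSet (c.branch x))⁻¹ *
    ∑' b : c.branch x, (c.piSet (c.branch (b : I))) ^ 2 / (c.mu (b : I) * c.invm (b : I))

/-- `Q_a = sup_{x ∈ ℓ(a)} Q_x`. -/
def Qsup (a : I) : ℝ≥0∞ := ⨆ x ∈ c.pathToRoot a, c.Qx x

/-- `R_a = Σ_{b ∈ ℓ(a)} π(B_b)²/(μ_b π(b))`. -/
def Rsum (a : I) : ℝ≥0∞ :=
  ∑' b : c.pathToRoot a, (c.piSet (c.branch (b : I))) ^ 2 / (c.mu (b : I) * c.invm (b : I))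

/-- The set `C_{a,k}`: union over the vertices `a_l`, `k < l ≤ d(a)`, of the path from
`a_k` to the root, of the branches stemming from the children of `a_l` other
than `a_{l-1}`. -/
def Cset (a : I) (k : ℕ) : Set I :=
  {y | ∃ l, k + 1 ≤ l ∧ l ≤ c.depth a ∧
    ∃ ch, ch ∈ c.children (c.par^[l] a) ∧ ch ≠ c.par^[l - 1] a ∧ y ∈ c.branch ch}

end TreeChain

/-- The strong drift condition `0^ℓ-SD` toward the root, for a family of chains
`c n` with distinguished vertices `a n` (the limit `a → ∞` being `n → ∞`). -/
def StrongDrift {I : ℕ → Type*} [∀ n, MeasurableSpace (I n)]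
    (c : ∀ n, TreeChain (I n)) (a : ∀ n, I n) : Prop :=
  (∃ Kmu : ℝ≥0∞, 0 < Kmu ∧
      ∀ n, ∀ b ∈ (c n).branch ((c n).alphaVert (a n)), Kmu ≤ (c n).mu b) ∧
  Tendsto (fun n => ((c n).Kdrift (a n)) ^ 2 / (c n).ET (a n) (c n).root) atTop (𝓝 0)


theorem tendsto_tsum_zero_of_dominated {α : Type*} {f : ℕ → α → ℝ≥0∞} (g : α → ℝ≥0∞)
    (hg : ∑' x, g x ≠ ∞) (hfg : ∀ n x, f n x ≤ g x)
    (hf : ∀ x, Tendsto (fun n => f n x) atTop (𝓝 0)) :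
    Tendsto (fun n => ∑' x, f n x) atTop (𝓝 0) := by
  let _ : MeasurableSpace α := ⊤
  have h := tendsto_lintegral_of_dominated_convergence (μ := Measure.count) (F := f)
    (f := fun _ => 0) g (fun _ => measurable_from_top)
    (fun n => Eventually.of_forall (hfg n)) (by rwa [lintegral_count]) (Eventually.of_forall hf)
  simpa [lintegral_count] using h

theorem tsum_add_eq_of_flux {S p q : ℕ → ℝ≥0∞} (h : ∀ m, S (m + 1) + p m = S m + q m)
    (hS : Tendsto S atTop (𝓝 0)) (m : ℕ) :
    ∑' i, p (m + i) = S m + ∑' i, q (m + i) := by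
  have key : ∀ M, S (m + M) + ∑ i ∈ Finset.range M, p (m + i)
      = S m + ∑ i ∈ Finset.range M, q (m + i) := by
    intro M
    induction M with
    | zero => simp
    | succ M ih =>
      rw [Finset.sum_range_succ, Finset.sum_range_succ, ← add_assoc (S m), ← ih,
        ← add_assoc m M 1, add_comm (∑ i ∈ Finset.range M, p (m + i)), ← add_assoc, h]
      ring
  have h1 : Tendsto (fun M => S (m + M) + ∑ i ∈ Finset.range M, p (m + i)) atTop
      (𝓝 (0 + ∑' i, p (m + i))) := by
    refine Tendsto.add ?_ (ENNReal.summable.hasSum.tendsto_sum_nat)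
    simpa [add_comm] using (tendsto_add_atTop_iff_nat m).2 hS
  have h2 : Tendsto (fun M => S m + ∑ i ∈ Finset.range M, q (m + i)) atTop
      (𝓝 (S m + ∑' i, q (m + i))) :=
    tendsto_const_nhds.add (ENNReal.summable.hasSum.tendsto_sum_nat)
  simp only [key] at h1
  simpa using tendsto_nhds_unique h1 h2

open Classical in
/-- The indicator that the trajectory avoids `y` up to time `m`. -/
def avoidInd {I : Type*} (y : I) (m : ℕ) (ω : ℕ → I) : ℝ≥0∞ :=
  if ∀ i ≤ m, ω i ≠ y then 1 else 0

theorem avoidInd_of_first {I : Type*} {y : I} {ω : ℕ → I} {N : ℕ} (hN : ω N = y)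
    (hlt : ∀ i < N, ω i ≠ y) (m : ℕ) : avoidInd y m ω = if m < N then 1 else 0 := by
  unfold avoidInd
  congr 1
  refine propext ⟨fun h => ?_, fun h i hi => hlt i (by omega)⟩
  by_contra hc
  exact h N (by omega) hN

theorem hitTime_of_first {I : Type*} {y : I} {ω : ℕ → I} {N : ℕ} (hN : ω N = y)
    (hlt : ∀ i < N, ω i ≠ y) : hitTime y ω = N := by
  refine le_antisymm (iInf₂_le N hN) (le_iInf₂ fun t ht => ?_)
  have : N ≤ t := by
    by_contra hc
    exact hlt t (by omega) ht
  exact_mod_cast this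

theorem hitTime_of_never {I : Type*} {y : I} {ω : ℕ → I} (h : ∀ t, ω t ≠ y) :
    hitTime y ω = ∞ := by
  simp [hitTime, h]

theorem tsum_ite_add_lt (N m : ℕ) :
    ∑' i : ℕ, (if m + i < N then (1 : ℝ≥0∞) else 0) = ((N - m : ℕ) : ℝ≥0∞) := by
  rw [tsum_eq_sum (s := Finset.range (N - m))]
  · rw [Finset.sum_congr rfl (g := fun _ => (1 : ℝ≥0∞))]
    · simp
    · intro i hi
      rw [if_pos]
      have := Finset.mem_range.1 hi
      omega
  · intro i hi
    rw [if_neg]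
    have : ¬ i < N - m := fun h => hi (Finset.mem_range.2 h)
    omega

theorem hitTime_eq_tsum {I : Type*} (y : I) (ω : ℕ → I) :
    hitTime y ω = ∑' m, avoidInd y m ω := by
  classical
  by_cases h : ∃ t, ω t = y
  · have h2 : ∀ i < Nat.find h, ω i ≠ y := fun i hi => Nat.find_min h hi
    rw [hitTime_of_first (Nat.find_spec h) h2]
    simp only [avoidInd_of_first (Nat.find_spec h) h2]
    simpa using (tsum_ite_add_lt (Nat.find h) 0).symm
  · push Not at h
    rw [hitTime_of_never h]
    simp [avoidInd, h]

theorem sq_hitTime_add_eq_tsum {I : Type*} (y : I) (ω : ℕ → I) :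
    hitTime y ω ^ 2 + hitTime y ω = 2 * ∑' m, ∑' i, avoidInd y (m + i) ω := by
  classical
  by_cases h : ∃ t, ω t = y
  · have h2 : ∀ i < Nat.find h, ω i ≠ y := fun i hi => Nat.find_min h hi
    rw [hitTime_of_first (Nat.find_spec h) h2]
    simp only [avoidInd_of_first (Nat.find_spec h) h2, tsum_ite_add_lt]
    generalize Nat.find h = N
    rw [tsum_eq_sum (s := Finset.range N) (fun m hm => by
      have : ¬ m < N := fun h => hm (Finset.mem_range.2 h)
      rw [Nat.sub_eq_zero_of_le (by omega), Nat.cast_zero])]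
    have : N ^ 2 + N = 2 * ∑ m ∈ Finset.range N, (N - m) := by
      induction N with
      | zero => simp
      | succ N ih =>
        rw [Finset.sum_range_succ']
        simp only [Nat.add_sub_add_right, Nat.sub_zero]
        rw [mul_add, ← ih]
        ring
    exact_mod_cast this
  · push Not at h
    rw [hitTime_of_never h]
    simp [avoidInd, h]

namespace TreeChain

section Tree

variable {I : Type*} [MeasurableSpace I] (c : TreeChain I)

theorem mem_branch_self (x : I) : x ∈ c.branch x := ⟨0, rfl⟩

variable {c}

theorem iterate_mem_branch (x : I) (n : ℕ) : x ∈ c.branch (c.par^[n] x) := ⟨n, rfl⟩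

theorem branch_trans {x y z : I} (h : x ∈ c.branch y) (h' : y ∈ c.branch z) :
    x ∈ c.branch z := by
  obtain ⟨n, rfl⟩ := h
  obtain ⟨m, rfl⟩ := h'
  exact ⟨m + n, Function.iterate_add_apply _ _ _ _⟩

theorem mem_branch_of_par {x y : I} (h : c.par x ∈ c.branch y) : x ∈ c.branch y := by
  obtain ⟨n, rfl⟩ := h
  exact ⟨n + 1, rfl⟩

theorem par_mem_branch {x y : I} (h : x ∈ c.branch y) (hxy : x ≠ y) : c.par x ∈ c.branch y := by
  obtain ⟨n, rfl⟩ := h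
  cases n with
  | zero => exact absurd rfl hxy
  | succ n => exact ⟨n, rfl⟩

theorem mem_branch_or {x y z : I} (h : x ∈ c.branch y) (h' : x ∈ c.branch z) :
    y ∈ c.branch z ∨ z ∈ c.branch y := by
  obtain ⟨n, rfl⟩ := h
  obtain ⟨m, rfl⟩ := h'
  rcases le_total n m with hnm | hnm
  · exact Or.inl ⟨m - n, by rw [← Function.iterate_add_apply, Nat.sub_add_cancel hnm]⟩
  · exact Or.inr ⟨n - m, by rw [← Function.iterate_add_apply, Nat.sub_add_cancel hnm]⟩

theorem depth_iterate (x : I) (n : ℕ) : c.depth (c.par^[n] x) = c.depth x - n := by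
  induction n generalizing x with
  | zero => rfl
  | succ n ih =>
    rw [Function.iterate_succ_apply, ih]
    by_cases hx : x = c.root
    · rw [hx, c.par_root, c.depth_root]; omega
    · have := c.depth_par x hx; omega

theorem mem_branch_root (x : I) : x ∈ c.branch c.root :=
  ⟨c.depth x, c.depth_eq_zero _ (by rw [depth_iterate]; omega)⟩

theorem depth_pos {x : I} (hx : x ≠ c.root) : 0 < c.depth x := by
  have := c.depth_par x hx; omega

theorem depth_le_of_mem_branch {x y : I} (h : x ∈ c.branch y) : c.depth y ≤ c.depth x := by
  obtain ⟨n, rfl⟩ := h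
  rw [depth_iterate]; omega

theorem par_notMem_branch {x : I} (hx : x ≠ c.root) : c.par x ∉ c.branch x := fun h => by
  have := depth_le_of_mem_branch h
  have := c.depth_par x hx
  omega

theorem mem_branch_antisymm {x y : I} (h : x ∈ c.branch y) (h' : y ∈ c.branch x) : x = y := by
  by_contra hne
  have hx : x ≠ c.root := by
    rintro rfl
    have h3 := depth_le_of_mem_branch h
    rw [c.depth_root] at h3
    exact hne (c.depth_eq_zero _ (by omega)).symm
  exact par_notMem_branch hx (branch_trans (par_mem_branch h hne) h')

theorem mem_pathToRoot {x b : I} : b ∈ c.pathToRoot x ↔ b ≠ c.root ∧ x ∈ c.branch b := by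
  constructor
  · rintro ⟨i, hi, rfl⟩
    refine ⟨fun h => ?_, iterate_mem_branch x i⟩
    have h2 := depth_iterate (c := c) x i
    rw [h, c.depth_root] at h2
    omega
  · rintro ⟨hb, i, rfl⟩
    refine ⟨i, ?_, rfl⟩
    have h2 := depth_iterate (c := c) x i
    have := depth_pos hb
    omega

theorem mem_Cset {a b : I} {k : ℕ} (hk : k ≤ c.depth a) :
    b ∈ c.Cset a k ↔ c.par^[k] a ∉ c.branch b ∧ b ∉ c.branch (c.par^[k] a) := by
  classical
  constructor
  · rintro ⟨l, hkl, hl, ch, ⟨hch, hpar⟩, hne, hb⟩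
    have hdep := c.depth_par ch hch
    rw [hpar, depth_iterate] at hdep
    have h1 : c.par^[k] a ∉ c.branch ch := by
      rintro ⟨i, hi⟩
      rw [← Function.iterate_add_apply] at hi
      have h2 := depth_iterate (c := c) a (i + k)
      rw [hi, hdep] at h2
      apply hne
      rw [← hi]
      congr 2
      omega
    refine ⟨fun h => h1 (branch_trans h hb), fun h => ?_⟩
    rcases mem_branch_or hb h with h2 | h2
    · have hne2 : ch ≠ c.par^[k] a := fun h3 => h1 (h3 ▸ c.mem_branch_self _)
      have h3 := depth_le_of_mem_branch (par_mem_branch h2 hne2)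
      rw [hpar, depth_iterate, depth_iterate] at h3
      omega
    · exact h1 h2
  · rintro ⟨h1, h2⟩
    have hex : ∃ i, c.par^[k] a ∈ c.branch (c.par^[i] b) := by
      obtain ⟨n, hn⟩ := mem_branch_root (c := c) b
      exact ⟨n, hn ▸ mem_branch_root _⟩
    obtain ⟨i, hi⟩ : ∃ i, Nat.find hex = i + 1 := by
      refine Nat.exists_eq_succ_of_ne_zero fun h0 => h1 ?_
      have := Nat.find_spec hex
      rwa [h0] at this
    have hspec := Nat.find_spec hex
    have hmin := Nat.find_min hex (m := i) (by omega)
    rw [hi, Function.iterate_succ_apply'] at hspec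
    set ch := c.par^[i] b with hch
    have hchr : ch ≠ c.root := fun h => hmin (h ▸ mem_branch_root _)
    obtain ⟨t, ht⟩ := hspec
    rw [← Function.iterate_add_apply] at ht
    have hdep := c.depth_par ch hchr
    obtain ⟨l, hlk, hld, hl⟩ : ∃ l, k ≤ l ∧ l ≤ c.depth a ∧ c.par^[l] a = c.par ch := by
      rcases le_total (t + k) (c.depth a) with h | h
      · exact ⟨t + k, by omega, h, ht⟩
      · refine ⟨c.depth a, hk, le_rfl, ?_⟩
        have e1 := depth_iterate (c := c) a (t + k)
        have e2 := depth_iterate (c := c) a (c.depth a)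
        rw [← ht, c.depth_eq_zero _ (e1.trans (by omega)), c.depth_eq_zero _ (e2.trans (by omega))]
    have hlk' : k ≠ l := by
      rintro rfl
      exact h2 (branch_trans (iterate_mem_branch b i) (mem_branch_of_par (hl ▸ c.mem_branch_self _)))
    refine ⟨l, by omega, hld, ch, ⟨hchr, hl.symm⟩, fun h => hmin ?_, iterate_mem_branch b i⟩
    rw [h]
    refine ⟨l - 1 - k, ?_⟩
    rw [← Function.iterate_add_apply]
    congr 2
    omega

theorem branch_cut {b z w : I} (hz : z ∈ c.branch b) (hw : w ∉ c.branch b)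
    (h : c.P z w ≠ 0) : z = b ∧ w = c.par b := by
  rcases c.P_support z w h with rfl | rfl | rfl
  · exact absurd hz hw
  · by_cases hzb : z = b
    · exact ⟨hzb, hzb ▸ rfl⟩
    · exact absurd (par_mem_branch hz hzb) hw
  · exact absurd (mem_branch_of_par hz) hw

theorem P_symm_ne_zero {z w : I} (h : c.P z w ≠ 0) : c.P w z ≠ 0 := fun h0 => by
  have := c.invm_rev z w
  rw [h0, mul_zero] at this
  exact (mul_ne_zero (c.invm_pos z) h) this

theorem P_le_one (x y : I) : c.P x y ≤ 1 := (ENNReal.le_tsum y).trans_eq (c.P_row x)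

theorem invm_le_one (x : I) : c.invm x ≤ 1 := (ENNReal.le_tsum x).trans_eq c.invm_sum

/-! ### Survival probabilities -/

variable (c)

open Classical in
/-- The probability that the chain started at `x` avoids `y` up to time `m`. -/
def survival (y : I) : ℕ → I → ℝ≥0∞
  | 0, x => if x = y then 0 else 1
  | m + 1, x => if x = y then 0 else ∑' z, c.P x z * survival y m z

/-- The expected hitting time of `y` started at `x`, in terms of survival probabilities. -/
def meanHit (y x : I) : ℝ≥0∞ := ∑' m, c.survival y m x

/-- Half of `E[T² + T]` for the hitting time `T` of `y` started at `x`. -/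
def halfSecond (y x : I) : ℝ≥0∞ := ∑' m, ∑' i, c.survival y (m + i) x

variable {c}

theorem survival_self (y : I) (m : ℕ) : c.survival y m y = 0 := by
  cases m <;> simp [survival]

theorem survival_zero {x y : I} (h : x ≠ y) : c.survival y 0 x = 1 := by
  simp [survival, h]

theorem survival_succ {x y : I} (h : x ≠ y) (m : ℕ) :
    c.survival y (m + 1) x = ∑' z, c.P x z * c.survival y m z := by
  simp [survival, h]

theorem survival_le_one (y : I) (m : ℕ) (x : I) : c.survival y m x ≤ 1 := by
  by_cases h : x = y
  · simp [h, survival_self]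
  · induction m generalizing x with
    | zero => simp [survival_zero h]
    | succ m ih =>
      rw [survival_succ h, ← c.P_row x]
      refine ENNReal.tsum_le_tsum fun z => mul_le_of_le_one_right' ?_
      by_cases hz : z = y
      · simp [hz, survival_self]
      · exact ih z hz

theorem meanHit_self (y : I) : c.meanHit y y = 0 := by simp [meanHit, survival_self]

theorem halfSecond_self (y : I) : c.halfSecond y y = 0 := by simp [halfSecond, survival_self]

theorem P_mul_meanHit_le (c : TreeChain I) {x y : I} (h : x ≠ y) (z : I) :
    c.P x z * c.meanHit y z ≤ c.meanHit y x := by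
  calc c.P x z * c.meanHit y z = ∑' m, c.P x z * c.survival y m z := ENNReal.tsum_mul_left.symm
    _ ≤ ∑' m, c.survival y (m + 1) x := by
        refine ENNReal.tsum_le_tsum fun m => ?_
        rw [survival_succ h]
        exact ENNReal.le_tsum z
    _ ≤ c.meanHit y x :=
        ENNReal.tsum_comp_le_tsum_of_injective (add_left_injective 1) _

open Classical in
/-- Reversible flux balance across the boundary of `A`. -/
theorem flux_balance (A : Set I) (f : I → ℝ≥0∞) :
    (∑' z, if z ∈ A then c.invm z * ∑' w, c.P z w * f w else 0) +
        ∑' z, ∑' w, (if z ∈ A ∧ w ∉ A then c.invm z * c.P z w * f z else 0) =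
      (∑' z, if z ∈ A then c.invm z * f z else 0) +
        ∑' z, ∑' w, (if z ∈ A ∧ w ∉ A then c.invm z * c.P z w * f w else 0) := by
  have h1 : (∑' z, if z ∈ A then c.invm z * ∑' w, c.P z w * f w else 0) =
      (∑' z, ∑' w, if z ∈ A ∧ w ∈ A then c.invm z * c.P z w * f w else 0) +
        ∑' z, ∑' w, (if z ∈ A ∧ w ∉ A then c.invm z * c.P z w * f w else 0) := by
    rw [← ENNReal.tsum_add]
    refine tsum_congr fun z => ?_
    rw [← ENNReal.tsum_add]
    by_cases hz : z ∈ A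
    · simp only [hz, if_true, true_and]
      rw [← ENNReal.tsum_mul_left]
      refine tsum_congr fun w => ?_
      by_cases hw : w ∈ A <;> simp [hw, mul_assoc]
    · simp [hz]
  have h2 : (∑' z, if z ∈ A then c.invm z * f z else 0) =
      (∑' z, ∑' w, if z ∈ A ∧ w ∈ A then c.invm z * c.P z w * f z else 0) +
        ∑' z, ∑' w, (if z ∈ A ∧ w ∉ A then c.invm z * c.P z w * f z else 0) := by
    rw [← ENNReal.tsum_add]
    refine tsum_congr fun z => ?_
    rw [← ENNReal.tsum_add]
    by_cases hz : z ∈ A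
    · simp only [hz, if_true, true_and]
      rw [← mul_one (c.invm z * f z), ← c.P_row z, ← ENNReal.tsum_mul_left]
      refine tsum_congr fun w => ?_
      by_cases hw : w ∈ A <;> simp [hw, mul_right_comm]
    · simp [hz]
  have h3 : (∑' z, ∑' w, if z ∈ A ∧ w ∈ A then c.invm z * c.P z w * f w else 0) =
      ∑' z, ∑' w, if z ∈ A ∧ w ∈ A then c.invm z * c.P z w * f z else 0 := by
    rw [ENNReal.tsum_comm]
    refine tsum_congr fun z => tsum_congr fun w => ?_
    simp only [c.invm_rev w z, and_comm]
  rw [h1, h2, h3]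
  ring

open Classical in
theorem invm_mul_P_mul_meanHit_le (c : TreeChain I) (x y : I) (h : x ≠ y) :
    c.invm x * c.P x y * c.meanHit y x ≤ 1 := by
  obtain ⟨A, hA⟩ : ∃ A : Set I, ∀ z, z ∈ A ↔ z ≠ y := ⟨{y}ᶜ, fun _ => Iff.rfl⟩
  set W : ℕ → ℝ≥0∞ := fun m => ∑' z, if z ∈ A then c.invm z * c.survival y m z else 0
    with hW
  have hstep : ∀ m, W (m + 1) + c.invm x * c.P x y * c.survival y m x ≤ W m := by
    intro m
    have hb := c.flux_balance A (c.survival y m)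
    have e1 : W (m + 1) = ∑' z, if z ∈ A then
        c.invm z * ∑' w, c.P z w * c.survival y m w else 0 := by
      refine tsum_congr fun z => ?_
      by_cases hz : z = y
      · simp [hA, hz]
      · simp [hA, hz, survival_succ hz]
    have e2 : ∑' z, ∑' w, (if z ∈ A ∧ w ∉ A then
        c.invm z * c.P z w * c.survival y m w else 0) = 0 := by
      simp only [ENNReal.tsum_eq_zero]
      intro z w
      by_cases hw : w = y
      · simp [hw, survival_self]
      · simp [hA, hw]
    rw [e2, add_zero, ← e1] at hb
    refine le_trans ?_ hb.le
    gcongr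
    refine le_trans ?_ (ENNReal.le_tsum x)
    refine le_trans ?_ (ENNReal.le_tsum y)
    simp [hA, h]
  have hsum : ∀ M, W M + ∑ m ∈ Finset.range M, c.invm x * c.P x y * c.survival y m x ≤ W 0 := by
    intro M
    induction M with
    | zero => simp
    | succ M ih =>
      rw [Finset.sum_range_succ, add_comm (Finset.sum _ _), ← add_assoc]
      exact (add_le_add_left (hstep M) _).trans ih
  have hW0 : W 0 ≤ 1 := by
    rw [← c.invm_sum]
    refine ENNReal.tsum_le_tsum fun z => ?_
    split_ifs
    · exact mul_le_of_le_one_right' (survival_le_one _ _ _)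
    · exact zero_le
  rw [meanHit, ← ENNReal.tsum_mul_left, ENNReal.tsum_eq_iSup_nat]
  exact iSup_le fun M => (le_add_self.trans (hsum M)).trans hW0

theorem meanHit_ne_top_of_P {x y z : I} (h : c.P x z ≠ 0) (hx : c.meanHit y x ≠ ∞) :
    c.meanHit y z ≠ ∞ := by
  intro htop
  by_cases hxy : x = y
  · subst hxy
    by_cases hz : z = x
    · rw [hz, meanHit_self] at htop
      exact ENNReal.zero_ne_top htop
    · have := c.invm_mul_P_mul_meanHit_le z x hz
      rw [htop, ENNReal.mul_top (mul_ne_zero (c.invm_pos z) (P_symm_ne_zero h))] at this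
      exact absurd this (by simp)
  · have := c.P_mul_meanHit_le hxy z
    rw [htop, ENNReal.mul_top h] at this
    exact hx (top_le_iff.1 this)

theorem meanHit_ne_top (y x : I) : c.meanHit y x ≠ ∞ := by
  have hup : ∀ n, c.meanHit y (c.par^[n] y) ≠ ∞ := by
    intro n
    induction n with
    | zero => simp [meanHit_self]
    | succ n ih =>
      rw [Function.iterate_succ_apply']
      by_cases hr : c.par^[n] y = c.root
      · rw [hr, c.par_root, ← hr]; exact ih
      · exact meanHit_ne_top_of_P (c.mu_pos _ hr) ih
  obtain ⟨n, hn⟩ := mem_branch_root (c := c) y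
  have hroot : c.meanHit y c.root ≠ ∞ := hn ▸ hup n
  induction hd : c.depth x generalizing x with
  | zero => rwa [c.depth_eq_zero x hd]
  | succ d ih =>
    have hx : x ≠ c.root := by
      rintro rfl
      rw [c.depth_root] at hd; omega
    have := c.depth_par x hx
    exact meanHit_ne_top_of_P (c.lam_pos x hx) (ih (c.par x) (by omega))

open Classical in
/-- The first and second moment identities across a single edge `{p, q}` cutting off a set `A`
not containing the target `y`. -/
theorem cut_moments {A : Set I} {p q y : I} (hp : p ∈ A) (hq : q ∉ A) (hy : y ∉ A)
    (hcut : ∀ z ∈ A, ∀ w ∉ A, c.P z w ≠ 0 → z = p ∧ w = q) :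
    c.invm p * c.P p q * c.meanHit y p = c.piSet A + c.invm p * c.P p q * c.meanHit y q ∧
    c.invm p * c.P p q * c.halfSecond y p =
      (∑' z, if z ∈ A then c.invm z * c.meanHit y z else 0) +
        c.invm p * c.P p q * c.halfSecond y q := by
  set S : ℕ → ℝ≥0∞ := fun m => ∑' z, if z ∈ A then c.invm z * c.survival y m z else 0 with hS
  have hne : ∀ z ∈ A, z ≠ y := fun z hz h => hy (h ▸ hz)
  have hsingle : ∀ g : I → I → ℝ≥0∞,
      (∑' z, ∑' w, if z ∈ A ∧ w ∉ A then c.invm z * c.P z w * g z w else 0) =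
        c.invm p * c.P p q * g p q := by
    intro g
    rw [tsum_eq_single p, tsum_eq_single q]
    · simp [hp, hq]
    · intro w hw
      split_ifs with h
      · have : c.P p w = 0 := by
          by_contra h0
          exact hw (hcut p hp w h.2 h0).2
        simp [this]
      · rfl
    · intro z hz
      rw [ENNReal.tsum_eq_zero]
      intro w
      split_ifs with h
      · have : c.P z w = 0 := by
          by_contra h0
          exact hz (hcut z h.1 w h.2 h0).1
        simp [this]
      · rfl
  have hstep : ∀ m, S (m + 1) + c.invm p * c.P p q * c.survival y m p =
      S m + c.invm p * c.P p q * c.survival y m q := by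
    intro m
    have hb := c.flux_balance A (c.survival y m)
    rw [hsingle fun z _ => c.survival y m z, hsingle fun _ w => c.survival y m w] at hb
    rw [← hb]
    congr 1
    refine tsum_congr fun z => ?_
    split_ifs with hz
    · rw [survival_succ (hne z hz)]
    · rfl
  have hlim : Tendsto S atTop (𝓝 0) := by
    refine tendsto_tsum_zero_of_dominated c.invm (by simp [c.invm_sum]) (fun m z => ?_) fun z => ?_
    · split_ifs
      · exact mul_le_of_le_one_right' (survival_le_one _ _ _)
      · exact zero_le
    · split_ifs
      · have h0 := ENNReal.Tendsto.const_mul (a := c.invm z)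
          (ENNReal.tendsto_atTop_zero_of_tsum_ne_top (c.meanHit_ne_top y z))
          (Or.inr ((c.invm_le_one z).trans_lt ENNReal.one_lt_top).ne)
        simpa using h0
      · exact tendsto_const_nhds
  have htail := tsum_add_eq_of_flux hstep hlim
  simp only [ENNReal.tsum_mul_left] at htail
  constructor
  · have h0 := htail 0
    simp only [zero_add] at h0
    have hS0 : S 0 = c.piSet A := by
      rw [piSet, tsum_subtype]
      refine tsum_congr fun z => ?_
      by_cases hz : z ∈ A
      · simp [hz, survival_zero (hne z hz)]
      · simp [hz]
    rwa [hS0] at h0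
  · have hSsum : ∑' m, S m = ∑' z, if z ∈ A then c.invm z * c.meanHit y z else 0 := by
      rw [hS, ENNReal.tsum_comm]
      refine tsum_congr fun z => ?_
      split_ifs
      · rw [ENNReal.tsum_mul_left, meanHit]
      · simp
    rw [← hSsum, halfSecond, halfSecond, ← ENNReal.tsum_mul_left, ← ENNReal.tsum_mul_left,
      ← ENNReal.tsum_add]
    exact tsum_congr htail

/-! ### Explicit formulas on the tree -/

/-- The conductance `μ_b π(b)` of the edge between `b` and its parent. -/
def cond (c : TreeChain I) (b : I) : ℝ≥0∞ := c.mu b * c.invm b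

theorem cond_ne_zero {b : I} (hb : b ≠ c.root) : c.cond b ≠ 0 :=
  mul_ne_zero (c.mu_pos b hb) (c.invm_pos b)

theorem cond_ne_top (b : I) : c.cond b ≠ ∞ :=
  ENNReal.mul_ne_top ((P_le_one _ _).trans_lt ENNReal.one_lt_top).ne
    ((invm_le_one _).trans_lt ENNReal.one_lt_top).ne

theorem meanHit_up {b y : I} (hb : b ≠ c.root) (hy : y ∉ c.branch b) :
    c.meanHit y b = c.meanHit y (c.par b) + c.piSet (c.branch b) / c.cond b := by
  have h := (cut_moments (c := c) (c.mem_branch_self b) (par_notMem_branch hb) hy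
    fun z hz w hw => branch_cut hz hw).1
  rw [show c.invm b * c.P b (c.par b) = c.cond b from mul_comm _ _] at h
  refine (ENNReal.mul_right_inj (cond_ne_zero hb) (cond_ne_top b)).1 ?_
  rw [h, mul_add, ENNReal.mul_div_cancel (cond_ne_zero hb) (cond_ne_top b), add_comm]

open Classical in
theorem moments_down {b y : I} (hb : b ≠ c.root) (hy : y ∈ c.branch b) :
    c.meanHit y (c.par b) = c.meanHit y b + c.piSet (c.branch b)ᶜ / c.cond b ∧
    c.halfSecond y (c.par b) = c.halfSecond y b +
      (∑' z, if z ∈ (c.branch b)ᶜ then c.invm z * c.meanHit y z else 0) / c.cond b := by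
  have h := cut_moments (c := c) (A := (c.branch b)ᶜ) (y := y) (par_notMem_branch hb)
    (fun h => h (c.mem_branch_self b)) (fun h => h hy)
    (fun z hz w hw h => (branch_cut (not_not.1 hw) hz (P_symm_ne_zero h)).symm)
  rw [show c.invm (c.par b) * c.P (c.par b) b = c.cond b by
    rw [c.invm_rev]; exact mul_comm _ _] at h
  constructor
  · refine (ENNReal.mul_right_inj (cond_ne_zero hb) (cond_ne_top b)).1 ?_
    rw [h.1, mul_add, ENNReal.mul_div_cancel (cond_ne_zero hb) (cond_ne_top b), add_comm]
  · refine (ENNReal.mul_right_inj (cond_ne_zero hb) (cond_ne_top b)).1 ?_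
    rw [h.2, mul_add, ENNReal.mul_div_cancel (cond_ne_zero hb) (cond_ne_top b), add_comm]
    congr!

open Classical in
/-- The mean time to reach `v` from `z`, as a sum over the edges of the path between them. -/
def pathMean (c : TreeChain I) (v z : I) : ℝ≥0∞ :=
  (∑' b, if v ∉ c.branch b ∧ z ∈ c.branch b then c.piSet (c.branch b) / c.cond b else 0) +
    ∑' b, if (b ≠ c.root ∧ v ∈ c.branch b) ∧ z ∉ c.branch b
      then c.piSet (c.branch b)ᶜ / c.cond b else 0

theorem pathMean_self (v : I) : c.pathMean v v = 0 := by
  classical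
  have h1 : ∀ b, ¬ (v ∉ c.branch b ∧ v ∈ c.branch b) := fun b h => h.1 h.2
  have h2 : ∀ b, ¬ ((b ≠ c.root ∧ v ∈ c.branch b) ∧ v ∉ c.branch b) := fun b h => h.2 h.1.2
  simp only [pathMean, h1, h2, if_false, tsum_zero, add_zero]

theorem par_mem_branch_iff {z b : I} (h : z ≠ b) : c.par z ∈ c.branch b ↔ z ∈ c.branch b :=
  ⟨mem_branch_of_par, fun h' => par_mem_branch h' h⟩

theorem pathMean_up {v z : I} (hz : z ≠ c.root) (hv : v ∉ c.branch z) :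
    c.pathMean v z = c.pathMean v (c.par z) + c.piSet (c.branch z) / c.cond z := by
  classical
  unfold pathMean
  rw [add_right_comm]
  congr 1
  · rw [← tsum_ite_eq z (fun b => c.piSet (c.branch b) / c.cond b), ← ENNReal.tsum_add]
    refine tsum_congr fun b => ?_
    by_cases hb : b = z
    · subst hb
      simp [hv, c.mem_branch_self, par_notMem_branch hz]
    · simp [hb, par_mem_branch_iff (Ne.symm hb)]
  · refine tsum_congr fun b => ?_
    by_cases hb : b = z
    · subst hb; simp [hv]
    · simp [par_mem_branch_iff (Ne.symm hb)]

theorem pathMean_down {v z : I} (hz : z ≠ c.root) (hv : v ∈ c.branch z) :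
    c.pathMean v (c.par z) = c.pathMean v z + c.piSet (c.branch z)ᶜ / c.cond z := by
  classical
  unfold pathMean
  rw [add_assoc]
  congr 1
  · refine tsum_congr fun b => ?_
    by_cases hb : b = z
    · subst hb; simp [hv]
    · simp [par_mem_branch_iff (Ne.symm hb)]
  · rw [← tsum_ite_eq z (fun b => c.piSet (c.branch b)ᶜ / c.cond b), ← ENNReal.tsum_add]
    refine tsum_congr fun b => ?_
    by_cases hb : b = z
    · subst hb
      simp [hv, hz, c.mem_branch_self, par_notMem_branch hz]
    · simp [hb, par_mem_branch_iff (Ne.symm hb)]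

theorem meanHit_eq_pathMean_add_of_ancestor {v y z : I} (hy : y ∈ c.branch v)
    (hz : v ∈ c.branch z) : c.meanHit y z = c.pathMean v z + c.meanHit y v := by
  obtain ⟨n, rfl⟩ := hz
  induction n with
  | zero => simp [pathMean_self]
  | succ n ih =>
    rw [Function.iterate_succ_apply']
    by_cases hr : c.par^[n] v = c.root
    · rw [hr, c.par_root, ← hr, ih]
    · have h := iterate_mem_branch (c := c) v n
      rw [pathMean_down hr h, (moments_down hr (branch_trans hy h)).1, ih, add_right_comm]

/-- Before hitting `y ∈ B_v`, the chain started outside `B_v` has to visit `v`. -/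
theorem meanHit_eq_pathMean_add {v y : I} (hy : y ∈ c.branch v) (z : I) (hz : z ∉ c.branch v) :
    c.meanHit y z = c.pathMean v z + c.meanHit y v := by
  induction hd : c.depth z generalizing z with
  | zero =>
    exact meanHit_eq_pathMean_add_of_ancestor hy (c.depth_eq_zero z hd ▸ mem_branch_root v)
  | succ d ih =>
    by_cases hv : v ∈ c.branch z
    · exact meanHit_eq_pathMean_add_of_ancestor hy hv
    · have hr : z ≠ c.root := fun h => hv (h ▸ mem_branch_root v)
      have hyz : y ∉ c.branch z := fun h => (mem_branch_or h hy).elim hz hv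
      have := c.depth_par z hr
      rw [pathMean_up hr hv, meanHit_up hr hyz,
        ih (c.par z) (fun h => hz (mem_branch_of_par h)) (by omega), add_right_comm]

open Classical in
theorem piSet_eq_tsum_ite (A : Set I) : c.piSet A = ∑' z, if z ∈ A then c.invm z else 0 := by
  rw [piSet, tsum_subtype]
  rfl

open Classical in
theorem tsum_invm_mul_pathMean (v : I) :
    (∑' z, if z ∈ (c.branch v)ᶜ then c.invm z * c.pathMean v z else 0) =
      (∑' b, if v ∉ c.branch b ∧ b ∉ c.branch v
        then c.piSet (c.branch b) ^ 2 / c.cond b else 0) +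
      ∑' b, if b ∈ c.pathToRoot v then c.piSet (c.branch b)ᶜ ^ 2 / c.cond b else 0 := by
  have hsplit : ∀ (p : I → Prop) (B : I → Set I) (g : I → ℝ≥0∞),
      (∑' z, if z ∈ (c.branch v)ᶜ then
        c.invm z * ∑' b, (if p b ∧ z ∈ B b then g b else 0) else 0) =
      ∑' b, if p b then c.piSet (B b ∩ (c.branch v)ᶜ) * g b else 0 := by
    intro p B g
    have : ∀ z, (if z ∈ (c.branch v)ᶜ then
        c.invm z * ∑' b, (if p b ∧ z ∈ B b then g b else 0) else 0) =
        ∑' b, if p b then (if z ∈ B b ∩ (c.branch v)ᶜ then c.invm z else 0) * g b else 0 := by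
      intro z
      split_ifs with hz
      · rw [← ENNReal.tsum_mul_left]
        refine tsum_congr fun b => ?_
        by_cases hp : p b <;> by_cases hzb : z ∈ B b <;> simp [hp, hzb, show z ∉ c.branch v from hz]
      · have hz' : z ∈ c.branch v := not_not.1 hz
        simp [hz']
    simp only [this]
    rw [ENNReal.tsum_comm]
    refine tsum_congr fun b => ?_
    split_ifs
    · rw [ENNReal.tsum_mul_right, piSet_eq_tsum_ite]
      congr!
    · simp
  have hadd : ∀ z, (if z ∈ (c.branch v)ᶜ then c.invm z * c.pathMean v z else 0) =
      (if z ∈ (c.branch v)ᶜ then c.invm z * ∑' b, (if v ∉ c.branch b ∧ z ∈ c.branch b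
        then c.piSet (c.branch b) / c.cond b else 0) else 0) +
      (if z ∈ (c.branch v)ᶜ then c.invm z * ∑' b, (if (b ≠ c.root ∧ v ∈ c.branch b) ∧
        z ∈ (c.branch b)ᶜ then c.piSet (c.branch b)ᶜ / c.cond b else 0) else 0) := by
    intro z
    split_ifs
    · rw [← mul_add]; rfl
    · simp
  simp only [hadd]
  rw [ENNReal.tsum_add]
  congr 1
  · refine Eq.trans (Eq.trans (by congr!) (hsplit (fun b => v ∉ c.branch b) c.branch
      (fun b => c.piSet (c.branch b) / c.cond b))) ?_
    refine tsum_congr fun b => ?_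
    by_cases hv : v ∈ c.branch b
    · simp [hv]
    · by_cases hb : b ∈ c.branch v
      · have : c.branch b ∩ (c.branch v)ᶜ = ∅ := by
          ext z
          simp only [Set.mem_inter_iff, Set.mem_compl_iff, Set.mem_empty_iff_false, iff_false,
            not_and, not_not]
          exact fun h => branch_trans h hb
        simp [hv, hb, this, piSet]
      · have : c.branch b ∩ (c.branch v)ᶜ = c.branch b :=
          Set.inter_eq_left.2 fun z hz hzv => (mem_branch_or hz hzv).elim hb hv
        simp [hv, hb, this, sq, mul_div_assoc]
  · refine Eq.trans (Eq.trans (by congr!) (hsplit (fun b => b ≠ c.root ∧ v ∈ c.branch b)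
      (fun b => (c.branch b)ᶜ) (fun b => c.piSet (c.branch b)ᶜ / c.cond b))) ?_
    refine tsum_congr fun b => ?_
    simp only [mem_pathToRoot]
    split_ifs with h
    · have : (c.branch b)ᶜ ∩ (c.branch v)ᶜ = (c.branch b)ᶜ :=
        Set.inter_eq_left.2 fun z hz hzv => hz (branch_trans hzv h.2)
      rw [this, sq, mul_div_assoc]
    · rfl

open Classical in
theorem tsum_invm_mul_meanHit {v y : I} (hy : y ∈ c.branch v) :
    (∑' z, if z ∈ (c.branch v)ᶜ then c.invm z * c.meanHit y z else 0) =
      (∑' b, if v ∉ c.branch b ∧ b ∉ c.branch v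
        then c.piSet (c.branch b) ^ 2 / c.cond b else 0) +
      (∑' b, if b ∈ c.pathToRoot v then c.piSet (c.branch b)ᶜ ^ 2 / c.cond b else 0) +
      c.piSet (c.branch v)ᶜ * c.meanHit y v := by
  rw [← tsum_invm_mul_pathMean, piSet_eq_tsum_ite, ← ENNReal.tsum_mul_right, ← ENNReal.tsum_add]
  refine tsum_congr fun z => ?_
  split_ifs with hz
  · rw [meanHit_eq_pathMean_add hy z hz, mul_add]
  · simp

theorem two_mul_halfSecond_iterate (a : I) {j n : ℕ} (hjn : j ≤ n) (hn : n ≤ c.depth a) :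
    2 * c.halfSecond (c.par^[j] a) (c.par^[n] a) = ∑ k ∈ Finset.Ico j n,
      2 / (c.mu (c.par^[k] a) * c.invm (c.par^[k] a)) *
        ((∑' b : c.Cset a k,
            c.piSet (c.branch (b : I)) ^ 2 / (c.mu (b : I) * c.invm (b : I))) +
          (∑' b : c.pathToRoot (c.par^[k] a),
            c.piSet (c.branch (b : I))ᶜ ^ 2 / (c.mu (b : I) * c.invm (b : I))) +
          c.piSet (c.branch (c.par^[k] a))ᶜ * c.meanHit (c.par^[j] a) (c.par^[k] a)) := by
  classical
  induction n, hjn using Nat.le_induction with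
  | base => simp [halfSecond_self]
  | succ n hjn ih =>
    have hr : c.par^[n] a ≠ c.root := fun h => by
      have h2 := depth_iterate (c := c) a n
      rw [h, c.depth_root] at h2
      omega
    have hy : c.par^[j] a ∈ c.branch (c.par^[n] a) :=
      ⟨n - j, by rw [← Function.iterate_add_apply, Nat.sub_add_cancel hjn]⟩
    have hC : c.Cset a n =
        {b | c.par^[n] a ∉ c.branch b ∧ b ∉ c.branch (c.par^[n] a)} :=
      Set.ext fun b => mem_Cset (by omega)
    rw [Finset.sum_Ico_succ_top hjn, ← ih (by omega), Function.iterate_succ_apply',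
      (moments_down hr hy).2, mul_add, tsum_invm_mul_meanHit hy, hC,
      tsum_subtype _ (fun b => c.piSet (c.branch b) ^ 2 / (c.mu b * c.invm b)),
      tsum_subtype _ (fun b => c.piSet (c.branch b)ᶜ ^ 2 / (c.mu b * c.invm b)),
      ← mul_div_assoc, ENNReal.mul_div_right_comm]
    simp only [cond, Set.indicator_apply, Set.mem_ofPred_eq]

/-! ### Laws of trajectories -/

open Classical in
theorem law_two_step (x z : I) : c.law x {ω | ω 0 = x ∧ ω 1 = z} = c.P x z := by
  have h := c.law_cyl x 1 (fun i => if i = 0 then x else z) rfl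
  simp only [Finset.range_one, Finset.prod_singleton, if_true, zero_add, one_ne_zero,
    if_false] at h
  rw [← h]
  congr 1
  ext ω
  simp [Nat.le_one_iff_eq_zero_or_eq_one]

/-- Measurable sets of trajectories do not distinguish trajectories which differ at one time by
two points not separated by measurable sets. -/
theorem update_mem_of_not_separated {α : Type*} [MeasurableSpace α] {z z' : α}
    (h : ∀ M : Set α, MeasurableSet M → (z ∈ M ↔ z' ∈ M)) {H : Set (ℕ → α)}
    (hH : MeasurableSet H) (ω : ℕ → α) (i : ℕ) (hω : Function.update ω i z ∈ H) :
    Function.update ω i z' ∈ H := by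
  let _ : MeasurableSpace Bool := ⊥
  have hf : Measurable fun b : Bool => Function.update ω i (bif b then z else z') := by
    refine measurable_pi_iff.2 fun k => ?_
    by_cases hk : k = i
    · subst hk
      intro M hM
      rw [MeasurableSpace.measurableSet_bot_iff]
      by_cases hz : z ∈ M
      · right
        ext b
        cases b <;> simp [hz, ← h M hM]
      · left
        ext b
        cases b <;> simp [hz, ← h M hM]
    · simp [Function.update_of_ne hk]
  rcases MeasurableSpace.measurableSet_bot_iff.1 (hf hH) with h0 | h0
  · have : true ∈ (fun b : Bool => Function.update ω i (bif b then z else z')) ⁻¹' H := hω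
    rw [h0] at this
    exact this.elim
  · have : false ∈ (fun b : Bool => Function.update ω i (bif b then z else z')) ⁻¹' H := by
      rw [h0]; trivial
    exact this

open Classical in
theorem P_eq_zero_of_not_separated [Countable I] {z z' : I} (hne : z ≠ z')
    (h : ∀ M : Set I, MeasurableSet M → (z ∈ M ↔ z' ∈ M)) (x : I) : c.P x z = 0 := by
  set A : I → Set (ℕ → I) := fun w => {ω | ω 0 = x ∧ ω 1 = w} with hA
  set H := toMeasurable (c.law x) (A z') with hH
  have hA' : A z' ⊆ H := subset_toMeasurable _ _
  have hAz : A z ⊆ H := by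
    intro ω hω
    have h1 : Function.update ω 1 z' ∈ H := hA' ⟨by simp [hω.1], by simp⟩
    have h2 := update_mem_of_not_separated (fun M hM => (h M hM).symm)
      (measurableSet_toMeasurable _ _) ω 1 h1
    rwa [← hω.2, Function.update_eq_self] at h2
  have hcover : {ω : ℕ → I | ω 0 = x} ⊆ H ∪ ⋃ w : {w // w ≠ z ∧ w ≠ z'}, A w := by
    intro ω hω
    by_cases h1 : ω 1 = z
    · exact Or.inl (hAz ⟨hω, h1⟩)
    · by_cases h2 : ω 1 = z'
      · exact Or.inl (hA' ⟨hω, h2⟩)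
      · exact Or.inr (Set.mem_iUnion.2 ⟨⟨ω 1, h1, h2⟩, hω, rfl⟩)
  have hle : 1 ≤ c.P x z' + ∑' w : {w // w ≠ z ∧ w ≠ z'}, c.P x w := by
    rw [← c.law_start x]
    refine (measure_mono hcover).trans ((measure_union_le _ _).trans ?_)
    refine add_le_add ?_ ((measure_iUnion_le _).trans ?_)
    · rw [hH, measure_toMeasurable, hA, law_two_step]
    · simp only [hA, law_two_step, le_refl]
  have hsum : ∑' w, c.P x w = c.P x z + (c.P x z' + ∑' w : {w // w ≠ z ∧ w ≠ z'}, c.P x w) := by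
    rw [show (∑' w : {w // w ≠ z ∧ w ≠ z'}, c.P x w) =
      ∑' w, ({w | w ≠ z ∧ w ≠ z'} : Set I).indicator (c.P x) w from
        tsum_subtype {w | w ≠ z ∧ w ≠ z'} (c.P x),
      ← tsum_ite_eq z (fun w => c.P x w), ← tsum_ite_eq z' (fun w => c.P x w),
      ← ENNReal.tsum_add, ← ENNReal.tsum_add]
    refine tsum_congr fun w => ?_
    by_cases h1 : w = z
    · simp [h1, hne]
    · by_cases h2 : w = z'
      · simp [h2, hne.symm]
      · simp [h1, h2]
  rw [c.P_row] at hsum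
  by_contra h0
  have hfin : c.P x z' + ∑' w : {w // w ≠ z ∧ w ≠ z'}, c.P x w ≠ ∞ := fun ht => by
    rw [ht, add_top] at hsum
    exact ENNReal.one_ne_top hsum
  have := ENNReal.lt_add_right hfin h0
  rw [add_comm _ (c.P x z), ← hsum] at this
  exact absurd hle (not_le.2 this)

/-- The cylinder formula forces the state space to be discrete. -/
theorem measurableSingletonClass [Countable I] (c : TreeChain I) : MeasurableSingletonClass I := by
  have hsep : ∀ z z' : I, z ≠ z' → ∃ M, MeasurableSet M ∧ z ∈ M ∧ z' ∉ M := by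
    intro z z' hne
    by_contra hcon
    push Not at hcon
    have h : ∀ M : Set I, MeasurableSet M → (z ∈ M ↔ z' ∈ M) := fun M hM =>
      ⟨hcon M hM, fun hz' => by_contra fun hz => hcon Mᶜ hM.compl hz hz'⟩
    by_cases hz : z = c.root
    · exact c.lam_pos z' (fun h0 => hne (hz.trans h0.symm))
        (P_eq_zero_of_not_separated hne.symm (fun M hM => (h M hM).symm) _)
    · exact c.lam_pos z hz (P_eq_zero_of_not_separated hne h _)
  refine ⟨fun z => ?_⟩
  choose M hM hzM hM' using fun z' : {z' // z ≠ z'} => hsep z z' z'.2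
  have : ({z} : Set I) = ⋂ z', M z' := by
    ext w
    simp only [Set.mem_singleton_iff, Set.mem_iInter]
    refine ⟨fun h z' => h ▸ hzM z', fun h => by_contra fun hw => ?_⟩
    exact hM' ⟨w, Ne.symm hw⟩ (h ⟨w, Ne.symm hw⟩)
  rw [this]
  exact MeasurableSet.iInter hM

/-- The weight of a finite path. -/
def pathWeight (c : TreeChain I) {n : ℕ} (g : Fin (n + 1) → I) : ℝ≥0∞ :=
  ∏ i : Fin n, c.P (g i.castSucc) (g i.succ)

theorem pathWeight_cons {n : ℕ} (x : I) (g : Fin (n + 1) → I) :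
    c.pathWeight (Fin.cons x g : Fin (n + 2) → I) = c.P x (g 0) * c.pathWeight g := by
  unfold pathWeight
  rw [Fin.prod_univ_succ]
  simp [Fin.castSucc_succ]

theorem law_path {n : ℕ} (g : Fin (n + 1) → I) :
    c.law (g 0) {ω | ∀ i : Fin (n + 1), ω i = g i} = c.pathWeight g := by
  have h := c.law_cyl (g 0) n (fun i => g (Fin.ofNat (n + 1) i)) rfl
  rw [Finset.prod_range] at h
  unfold pathWeight
  convert h using 2
  · ext ω
    simp only [Set.mem_ofPred_eq]
    constructor
    · intro hω i hi
      have := hω (Fin.ofNat (n + 1) i)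
      rwa [Fin.val_ofNat, Nat.mod_eq_of_lt (by omega)] at this
    · intro hω i
      have := hω i (by omega)
      simpa using this
  · rename_i i _
    have e1 : Fin.ofNat (n + 1) (i : ℕ) = i.castSucc := by
      ext; simp
    have e2 : Fin.ofNat (n + 1) ((i : ℕ) + 1) = i.succ := by
      ext; simp
    rw [e1, e2]

open Classical in
theorem tsum_pathWeight (y : I) (n : ℕ) (x : I) :
    ∑' γ : Fin n → I, (if ∀ i, (Fin.cons x γ : Fin (n + 1) → I) i ≠ y
      then c.pathWeight (Fin.cons x γ : Fin (n + 1) → I) else 0) = c.survival y n x := by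
  induction n generalizing x with
  | zero => simp [survival, pathWeight, tsum_fintype]
  | succ n ih =>
    rw [← (Fin.consEquiv fun _ : Fin (n + 1) => I).tsum_eq, ENNReal.tsum_prod']
    by_cases hx : x = y
    · simp [hx, survival_self, Fin.forall_fin_succ]
    · rw [survival_succ hx]
      refine tsum_congr fun z => ?_
      rw [← ih, ← ENNReal.tsum_mul_left]
      refine tsum_congr fun γ => ?_
      simp only [Fin.consEquiv_apply, pathWeight_cons, Fin.cons_zero, mul_ite, mul_zero]
      congr 1
      rw [Fin.forall_fin_succ]
      simp [hx]

theorem measurable_avoidInd [MeasurableSingletonClass I] (y : I) (m : ℕ) :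
    Measurable (avoidInd y m : (ℕ → I) → ℝ≥0∞) := by
  classical
  refine Measurable.ite ?_ measurable_const measurable_const
  have : {ω : ℕ → I | ∀ i ≤ m, ω i ≠ y} = ⋂ i, ⋂ (_ : i ≤ m), (fun ω => ω i) ⁻¹' {y}ᶜ := by
    ext ω; simp
  rw [this]
  exact MeasurableSet.iInter fun i => MeasurableSet.iInter fun _ =>
    measurable_pi_apply i (measurableSet_singleton y).compl

theorem lintegral_avoidInd [Countable I] [MeasurableSingletonClass I] (y x : I) (m : ℕ) :
    ∫⁻ ω, avoidInd y m ω ∂(c.law x) = c.survival y m x := by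
  classical
  have hprob := c.law_prob x
  have hae : ∀ᵐ ω ∂(c.law x), ω 0 = x := by
    have hms : MeasurableSet {ω : ℕ → I | ω 0 = x} :=
      (measurable_pi_apply (X := fun _ : ℕ => I) 0) (measurableSet_singleton x)
    exact (prob_compl_eq_zero_iff hms).2 (c.law_start x)
  set r : (ℕ → I) → (Fin m → I) := fun ω i => ω (i + 1) with hr
  have hrm : Measurable r := measurable_pi_iff.2 fun i => measurable_pi_apply _
  set F : (Fin m → I) → ℝ≥0∞ := fun γ =>
    if ∀ i, (Fin.cons x γ : Fin (m + 1) → I) i ≠ y then 1 else 0 with hF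
  have hcons : ∀ ω : ℕ → I, ω 0 = x → ∀ i : Fin (m + 1),
      (Fin.cons x (r ω) : Fin (m + 1) → I) i = ω i := by
    intro ω hω i
    cases i using Fin.cases with
    | zero => simp [hω]
    | succ i => simp [hr]
  have h1 : ∫⁻ ω, avoidInd y m ω ∂(c.law x) = ∫⁻ ω, F (r ω) ∂(c.law x) := by
    refine lintegral_congr_ae (hae.mono fun ω hω => ?_)
    simp only [hF, avoidInd, hcons ω hω]
    congr 1
    exact propext ⟨fun h i => h i (by omega), fun h i hi => h ⟨i, by omega⟩⟩
  rw [h1, ← lintegral_map (measurable_of_countable F) hrm, lintegral_countable',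
    ← tsum_pathWeight]
  refine tsum_congr fun γ => ?_
  have h2 : (c.law x).map r {γ} = c.pathWeight (Fin.cons x γ : Fin (m + 1) → I) := by
    rw [Measure.map_apply hrm (measurableSet_singleton γ), ← law_path]
    refine measure_congr (hae.mono fun ω hω => propext ?_)
    change r ω = γ ↔ ∀ i : Fin (m + 1), ω i = (Fin.cons x γ : Fin (m + 1) → I) i
    rw [Fin.forall_fin_succ]
    simp [hω, hr, funext_iff]
  rw [h2]
  simp only [hF, ite_mul, one_mul, zero_mul]

theorem ET_eq_meanHit [Countable I] (x y : I) : c.ET x y = c.meanHit y x := by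
  have := c.measurableSingletonClass
  simp only [ET, hitTime_eq_tsum, meanHit]
  rw [lintegral_tsum fun m => (measurable_avoidInd y m).aemeasurable]
  simp only [lintegral_avoidInd]

theorem ET2_add_ET [Countable I] (x y : I) : c.ET2 x y + c.ET x y = 2 * c.halfSecond y x := by
  have := c.measurableSingletonClass
  have hm : Measurable (hitTime y : (ℕ → I) → ℝ≥0∞) := by
    rw [funext (hitTime_eq_tsum y)]
    exact Measurable.tsum fun m => measurable_avoidInd y m
  rw [ET2, ET, ← lintegral_add_right _ hm]
  simp only [sq_hitTime_add_eq_tsum, halfSecond]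
  rw [lintegral_const_mul, lintegral_tsum]
  · congr 1
    refine tsum_congr fun m => ?_
    rw [lintegral_tsum fun i => (measurable_avoidInd y _).aemeasurable]
    simp only [lintegral_avoidInd]
  · exact fun m => (Measurable.tsum fun i => measurable_avoidInd y _).aemeasurable
  · exact Measurable.tsum fun m => Measurable.tsum fun i =>
      measurable_avoidInd y _

end Tree

end TreeChain

/-- **Proposition (second moments), ancestor → descendant**: for `0 ≤ j < n ≤ d(a)`,
`E[(T^{a_n}_{a_j})²] = Σ_{k=j}^{n−1} (2/(μ_{a_k} π(a_k)))·(Σ_{c∈C_{a,k}} π(B_c)²/(μ_c π(c))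
 + Σ_{b∈ℓ(a_k)} π(I∖B_b)²/(μ_b π(b)) + π(I∖B_{a_k})·E[T^{a_k}_{a_j}]) − E[T^{a_n}_{a_j}]`,
in the equivalent additive form. -/
theorem ET2_iterate_down {I : Type*} [MeasurableSpace I] [Countable I]
    (c : TreeChain I) (a : I) (ha : a ≠ c.root)
    (j n : ℕ) (hjn : j < n) (hn : n ≤ c.depth a) :
    c.ET2 (c.par^[n] a) (c.par^[j] a) + c.ET (c.par^[n] a) (c.par^[j] a)
      = ∑ k ∈ Finset.Ico j n,
          2 / (c.mu (c.par^[k] a) * c.invm (c.par^[k] a)) *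
            ((∑' cc : c.Cset a k,
                (c.piSet (c.branch (cc : I))) ^ 2 / (c.mu (cc : I) * c.invm (cc : I))) +
             (∑' b : c.pathToRoot (c.par^[k] a),
                (c.piSet ((c.branch (b : I))ᶜ)) ^ 2 / (c.mu (b : I) * c.invm (b : I))) +
             c.piSet ((c.branch (c.par^[k] a))ᶜ) * c.ET (c.par^[k] a) (c.par^[j] a)) := by
  simp only [TreeChain.ET2_add_ET]
  rw [TreeChain.two_mul_halfSecond_iterate a hjn.le hn]
  simp only [TreeChain.ET_eq_meanHit]
end
end

section
/- Fix a vertex a ≠ 0 and define Q_x := (1/π(B_x))·Σ_{b∈B_x} π(B_b)²/(μ_b·π(b)) for x ≠ 0, Q_a := sup_{x∈ℓ(a)} Q_x, R_a := Σ_{b∈ℓ(a)} π(B_b)²/(μ_b·π(b)), K_a := sup_{b∈B_{α(a)}} π(B_b)/π(b) where α(a) := a_{d(a)−1} is the child of 0 on the path from a to 0, and K_μ := inf_{b∈B_{α(a)}} μ_b. Then R_a ≤ Q_a ≤ K_a²/K_μ. -/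
open MeasureTheory ProbabilityTheory Filter Topology ENNReal

noncomputable section

namespace TreeChain

variable {I : Type*} [MeasurableSpace I] (c : TreeChain I)

lemma branch_subset_branch {x y : I} (h : x ∈ c.branch y) : c.branch x ⊆ c.branch y := by
  obtain ⟨m, rfl⟩ := h
  rintro z ⟨n, rfl⟩
  exact ⟨m + n, Function.iterate_add_apply _ _ _ _⟩

lemma pathToRoot_subset_branch_alphaVert (a : I) :
    c.pathToRoot a ⊆ c.branch (c.alphaVert a) := by
  rintro y ⟨i, hi, rfl⟩
  refine ⟨c.depth a - 1 - i, ?_⟩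
  rw [← Function.iterate_add_apply, alphaVert]
  congr 2
  omega

lemma alphaVert_mem_pathToRoot {a : I} (ha : a ≠ c.root) : c.alphaVert a ∈ c.pathToRoot a :=
  ⟨c.depth a - 1, Nat.sub_lt (Nat.pos_of_ne_zero fun h ↦ ha (c.depth_eq_zero a h)) one_pos, rfl⟩

lemma piSet_le_one (A : Set I) : c.piSet A ≤ 1 :=
  c.invm_sum ▸ ENNReal.tsum_comp_le_tsum_of_injective Subtype.val_injective c.invm

lemma invm_ne_top (x : I) : c.invm x ≠ ∞ :=
  ((c.invm_sum ▸ ENNReal.le_tsum x : c.invm x ≤ 1).trans_lt one_lt_top).ne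

lemma tsum_branch_le_Qx (x : I) :
    ∑' b : c.branch x, c.piSet (c.branch (b : I)) ^ 2 / (c.mu (b : I) * c.invm (b : I)) ≤
      c.Qx x :=
  le_mul_of_one_le_left' (ENNReal.one_le_inv.2 (c.piSet_le_one _))

lemma Qx_le_of_forall_le {x : I} {C : ℝ≥0∞}
    (h : ∀ b ∈ c.branch x,
      c.piSet (c.branch b) ^ 2 / (c.mu b * c.invm b) ≤ C * c.invm b) :
    c.Qx x ≤ C := by
  calc c.Qx x ≤ (c.piSet (c.branch x))⁻¹ * ∑' b : c.branch x, C * c.invm (b : I) := by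
        unfold Qx
        gcongr with b
        exact h b b.2
    _ = C * ((c.piSet (c.branch x))⁻¹ * c.piSet (c.branch x)) := by
        rw [ENNReal.tsum_mul_left, ← piSet, mul_left_comm]
    _ ≤ C := mul_le_of_le_one_right' (ENNReal.inv_mul_le_one _)

lemma sq_div_mul_invm (b : I) (p : ℝ≥0∞) :
    p ^ 2 / (c.mu b * c.invm b) = (p / c.invm b) ^ 2 / c.mu b * c.invm b := by
  have h0 := c.invm_pos b
  have ht := c.invm_ne_top b
  have hc := ENNReal.inv_mul_cancel h0 ht
  rw [div_eq_mul_inv, ENNReal.mul_inv (.inr ht) (.inr h0), div_eq_mul_inv, div_eq_mul_inv]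
  calc p ^ 2 * ((c.mu b)⁻¹ * (c.invm b)⁻¹)
      = p ^ 2 * ((c.mu b)⁻¹ * (c.invm b)⁻¹) * ((c.invm b)⁻¹ * c.invm b) := by rw [hc, mul_one]
    _ = (p * (c.invm b)⁻¹) ^ 2 * (c.mu b)⁻¹ * c.invm b := by ring

end TreeChain

/-- **Lemma 4.1**: `R_a ≤ Q_a ≤ K_a²/K_μ`, where
`Q_x = π(B_x)⁻¹·Σ_{b∈B_x} π(B_b)²/(μ_b π(b))`, `Q_a = sup_{x∈ℓ(a)} Q_x`,
`R_a = Σ_{b∈ℓ(a)} π(B_b)²/(μ_b π(b))`, `K_a = sup_{b∈B_{α(a)}} π(B_b)/π(b)` and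
`K_μ = inf_{b∈B_{α(a)}} μ_b`. -/
theorem Rsum_le_Qsup_le {I : Type*} [MeasurableSpace I] [Countable I]
    (c : TreeChain I) (a : I) (ha : a ≠ c.root) :
    c.Rsum a ≤ c.Qsup a ∧
    c.Qsup a ≤ (⨆ b ∈ c.branch (c.alphaVert a), c.piSet (c.branch b) / c.invm b) ^ 2 /
        ⨅ b ∈ c.branch (c.alphaVert a), c.mu b := by
  have hsub := c.pathToRoot_subset_branch_alphaVert a
  refine ⟨?_, iSup₂_le fun x hx ↦ c.Qx_le_of_forall_le fun b hb ↦ ?_⟩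
  · calc c.Rsum a ≤ _ := ENNReal.tsum_mono_subtype
          (fun b ↦ c.piSet (c.branch b) ^ 2 / (c.mu b * c.invm b)) hsub
      _ ≤ c.Qx (c.alphaVert a) := c.tsum_branch_le_Qx _
      _ ≤ c.Qsup a := le_iSup₂ (f := fun x _ ↦ c.Qx x) _ (c.alphaVert_mem_pathToRoot ha)
  · have hbα := c.branch_subset_branch (hsub hx) hb
    rw [c.sq_div_mul_invm]
    gcongr
    · exact le_iSup₂ (f := fun b _ ↦ c.piSet (c.branch b) / c.invm b) b hbα
    · exact iInf₂_le b hbα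
end
end
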